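/- For all 0 < α ≤ 1/2 and 0 < β ≤ 1/2, the sequence b_n := Γ_B^(n)(⌊α·2^n⌋, 2⌊βn/2⌋) satisfies: Γ_IID(α,β) ≤ liminf_{n→∞} b_n and limsup_{n→∞} b_n ≤ 2(1−β)·Γ_IID(α,β). -/

import Mathlib

open Finset

noncomputable section

/-- The Hamming ball of radius `r` around the all-ones vector in `{-1,1}^n`
(vertices modeled as `Fin n → ℤˣ`, where `ℤˣ = {1, -1}`). -/
def hBall (n r : ℕ) : Finset (Fin n → ℤˣ) :=
  Finset.univ.filter fun z => hammingDist z 1 ≤ r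

/-- The Hamming sphere of radius `r` around the all-ones vector. -/
def hSphere (n r : ℕ) : Finset (Fin n → ℤˣ) :=
  Finset.univ.filter fun z => hammingDist z 1 = r

/-- Ball-noise stability `E[f(X) f(X∘Z)]`, `X` uniform on the cube, `Z` uniform on `B_r`. -/
def BStab (n r : ℕ) (f : (Fin n → ℤˣ) → ℝ) : ℝ :=
  (∑ x : Fin n → ℤˣ, ∑ z ∈ hBall n r, f x * f (x * z)) / (2 ^ n * (hBall n r).card)

/-- Sphere-noise stability `E[f(X) f(X∘Z)]`, `X` uniform on the cube, `Z` uniform on `S_r`. -/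
def SStab (n r : ℕ) (f : (Fin n → ℤˣ) → ℝ) : ℝ :=
  (∑ x : Fin n → ℤˣ, ∑ z ∈ hSphere n r, f x * f (x * z)) / (2 ^ n * (hSphere n r).card)

/-- i.i.d.-noise stability `E[f(X) f(X∘Z)]`, `Z` with i.i.d. coordinates equal to `-1`
with probability `β` and `1` with probability `1-β`. -/
def Stab (n : ℕ) (β : ℝ) (f : (Fin n → ℤˣ) → ℝ) : ℝ :=
  (∑ x : Fin n → ℤˣ, ∑ z : Fin n → ℤˣ,
      (∏ i, if z i = 1 then 1 - β else β) * (f x * f (x * z))) / 2 ^ n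

/-- Indicator function of a set `A` of vertices. -/
def indic (n : ℕ) (A : Finset (Fin n → ℤˣ)) : (Fin n → ℤˣ) → ℝ :=
  fun x => if x ∈ A then 1 else 0

/-- `Γ_B^(n)(M,r)`: maximal ball-noise stability over Boolean functions with exactly `M` ones. -/
def GammaB (n M r : ℕ) : ℝ :=
  sSup {y | ∃ A : Finset (Fin n → ℤˣ), A.card = M ∧ y = BStab n r (indic n A)}

/-- `Γ_S^(n)(M,r)`: maximal sphere-noise stability over Boolean functions with exactly `M` ones. -/
def GammaS (n M r : ℕ) : ℝ :=
  sSup {y | ∃ A : Finset (Fin n → ℤˣ), A.card = M ∧ y = SStab n r (indic n A)}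

/-- `Γ_IID^(n)(M,β)`: maximal i.i.d.-noise stability over Boolean functions with exactly `M` ones. -/
def GammaIID (n M : ℕ) (β : ℝ) : ℝ :=
  sSup {y | ∃ A : Finset (Fin n → ℤˣ), A.card = M ∧ y = Stab n β (indic n A)}

/-- `Γ_IID(α,β) := sup_n Γ_IID^(n)(⌊α·2^n⌋, β)` (equivalently the limit, by monotonicity). -/
def GammaIIDlim (α β : ℝ) : ℝ := ⨆ n : ℕ, GammaIID n ⌊α * 2 ^ n⌋₊ β

/-- `C(n, ≤ r) = Σ_{i=0}^r C(n,i)`. -/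
def ballBinom (n r : ℕ) : ℕ := ∑ i ∈ Finset.range (r + 1), n.choose i

open Filter

/-- The `i`-th coordinate of a vertex as a real number. -/
def coordR {n : ℕ} (i : Fin n) (z : Fin n → ℤˣ) : ℝ := ((z i : ℤ) : ℝ)

/-- The Walsh character `∏_{i ∈ S} z_i`. -/
def walsh {n : ℕ} (S : Finset (Fin n)) (z : Fin n → ℤˣ) : ℝ := ∏ i ∈ S, coordR i z

/-- The (unnormalized) Walsh transform. -/
def walshSum {n : ℕ} (w : (Fin n → ℤˣ) → ℝ) (S : Finset (Fin n)) : ℝ := ∑ z, w z * walsh S z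

/-- The (unnormalized) correlation `∑_{x,z} w(z) f(x) f(x∘z)`. -/
def corr {n : ℕ} (w f : (Fin n → ℤˣ) → ℝ) : ℝ := ∑ x, ∑ z, w z * (f x * f (x * z))

/-- The vertex whose only `-1` coordinate is `i`. -/
def flipAt {n : ℕ} (i : Fin n) : Fin n → ℤˣ := fun j => if j = i then -1 else 1

section Characters

variable {n : ℕ}

lemma coordR_eq_one_or (i : Fin n) (z : Fin n → ℤˣ) :
    (z i = 1 ∧ coordR i z = 1) ∨ (z i = -1 ∧ coordR i z = -1) := by
  rcases Int.units_eq_one_or (z i) with h | h <;> simp [coordR, h]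

lemma coordR_mul (i : Fin n) (x z : Fin n → ℤˣ) :
    coordR i (x * z) = coordR i x * coordR i z := by simp [coordR]

lemma coordR_mul_self (i : Fin n) (z : Fin n → ℤˣ) : coordR i z * coordR i z = 1 := by
  rcases coordR_eq_one_or i z with h | h <;> simp [h.2]

lemma coordR_flipAt (i j : Fin n) : coordR j (flipAt i) = if j = i then -1 else 1 := by
  unfold coordR flipAt; split_ifs <;> simp

lemma walsh_mul (S : Finset (Fin n)) (x z : Fin n → ℤˣ) :
    walsh S (x * z) = walsh S x * walsh S z := by
  simp [walsh, coordR_mul, prod_mul_distrib]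

lemma walsh_mul_self (S : Finset (Fin n)) (z : Fin n → ℤˣ) : walsh S z * walsh S z = 1 := by
  simp [walsh, ← prod_mul_distrib, coordR_mul_self]

lemma abs_walsh (S : Finset (Fin n)) (z : Fin n → ℤˣ) : |walsh S z| = 1 := by
  have h := walsh_mul_self S z
  rw [← abs_mul_abs_self] at h
  nlinarith [abs_nonneg (walsh S z)]

lemma walsh_flipAt (S : Finset (Fin n)) (i : Fin n) :
    walsh S (flipAt i) = if i ∈ S then -1 else 1 := by
  simp only [walsh, coordR_flipAt]
  rw [Finset.prod_ite_eq' S i (fun _ => (-1 : ℝ))]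

lemma walsh_insert {S : Finset (Fin n)} {i : Fin n} (hi : i ∉ S) (z : Fin n → ℤˣ) :
    walsh (insert i S) z = coordR i z * walsh S z := by
  simp [walsh, prod_insert hi]

lemma walsh_erase {S : Finset (Fin n)} {i : Fin n} (hi : i ∈ S) (z : Fin n → ℤˣ) :
    walsh (S.erase i) z = coordR i z * walsh S z := by
  conv_rhs => rw [← insert_erase hi, walsh_insert (notMem_erase i S)]
  rw [← mul_assoc, coordR_mul_self, one_mul]

lemma mul_self_cube (x : Fin n → ℤˣ) : x * x = 1 := by
  ext i; simp

lemma sum_walsh (z : Fin n → ℤˣ) :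
    ∑ S : Finset (Fin n), walsh S z = if z = 1 then 2 ^ n else 0 := by
  have h : ∑ S : Finset (Fin n), walsh S z = ∏ i, (1 + coordR i z) := by
    rw [prod_one_add, powerset_univ]; rfl
  rw [h]
  split_ifs with hz
  · subst hz; norm_num [coordR]
  · obtain ⟨i, hi⟩ := Function.ne_iff.mp hz
    refine prod_eq_zero (mem_univ i) ?_
    rcases coordR_eq_one_or i z with h | h
    · exact absurd h.1 hi
    · simp [h.2]

/-- Parseval for correlations. -/
lemma two_pow_mul_corr (w f : (Fin n → ℤˣ) → ℝ) :
    2 ^ n * corr w f = ∑ S, walshSum w S * walshSum f S ^ 2 := by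
  have expand : ∀ S : Finset (Fin n), walshSum w S * walshSum f S ^ 2 =
      ∑ x, ∑ z, ∑ y, w z * (f x * f y) * walsh S (x * z * y) := by
    intro S
    rw [pow_two, walshSum, walshSum, ← mul_assoc, sum_mul_sum, sum_comm, sum_mul]
    refine sum_congr rfl fun x _ => ?_
    rw [sum_mul_sum]
    refine sum_congr rfl fun z _ => sum_congr rfl fun y _ => ?_
    rw [walsh_mul, walsh_mul]; ring
  simp_rw [expand]
  rw [sum_comm, corr, mul_sum]
  refine sum_congr rfl fun x _ => ?_
  rw [sum_comm, mul_sum]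
  refine sum_congr rfl fun z _ => ?_
  rw [sum_comm]
  simp_rw [← mul_sum, sum_walsh]
  rw [sum_eq_single (x * z)]
  · simp [mul_self_cube]; ring
  · intro y _ hy
    rw [if_neg, mul_zero]
    intro h
    apply hy
    rw [← mul_one (x * z), ← mul_self_cube y, ← mul_assoc, h, one_mul]
  · simp

lemma corr_le_corr_of_walshSum_le {w₁ w₂ f : (Fin n → ℤˣ) → ℝ}
    (h : ∀ S, walshSum f S ≠ 0 → walshSum w₁ S ≤ walshSum w₂ S) : corr w₁ f ≤ corr w₂ f := by
  have hp : (0 : ℝ) < 2 ^ n := by positivity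
  refine le_of_mul_le_mul_left ?_ hp
  rw [two_pow_mul_corr, two_pow_mul_corr]
  refine sum_le_sum fun S _ => ?_
  by_cases hS : walshSum f S = 0
  · simp [hS]
  · exact mul_le_mul_of_nonneg_right (h S hS) (sq_nonneg _)

end Characters

/-- The i.i.d. noise distribution. -/
def iidWeight (n : ℕ) (β : ℝ) (z : Fin n → ℤˣ) : ℝ := ∏ i, if z i = 1 then 1 - β else β

section IID

variable {n : ℕ} {β : ℝ}

lemma iidWeight_nonneg (h0 : 0 ≤ β) (h1 : β ≤ 1) (z : Fin n → ℤˣ) : 0 ≤ iidWeight n β z :=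
  prod_nonneg fun i _ => by split_ifs <;> linarith

lemma sum_units (g : ℤˣ → ℝ) : ∑ u, g u = g 1 + g (-1) := by
  have : (univ : Finset ℤˣ) = {1, -1} := by decide
  rw [this, sum_pair (by decide)]

lemma walshSum_iidWeight (S : Finset (Fin n)) :
    walshSum (iidWeight n β) S = (1 - 2 * β) ^ S.card := by
  have h : ∀ z : Fin n → ℤˣ, iidWeight n β z * walsh S z =
      ∏ i, ((if z i = 1 then 1 - β else β) * if i ∈ S then ((z i : ℤ) : ℝ) else 1) := by
    intro z
    rw [prod_mul_distrib, prod_ite_mem, univ_inter]; rfl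
  simp_rw [walshSum, h]
  have h2 := prod_univ_sum (fun _ : Fin n => (univ : Finset ℤˣ))
    (fun i u => (if u = 1 then 1 - β else β) * if i ∈ S then ((u : ℤ) : ℝ) else 1)
  rw [Fintype.piFinset_univ] at h2
  rw [← h2]
  have h3 : ∀ i : Fin n, ∑ u : ℤˣ, ((if u = 1 then 1 - β else β) *
      if i ∈ S then ((u : ℤ) : ℝ) else 1) = if i ∈ S then 1 - 2 * β else 1 := by
    intro i
    rw [sum_units]
    have : (-1 : ℤˣ) ≠ 1 := by decide
    split_ifs <;> simp_all
    ring
  simp_rw [h3]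
  rw [prod_ite_mem, univ_inter, prod_const]

lemma sum_iidWeight : ∑ z, iidWeight n β z = 1 := by
  simpa [walshSum, walsh] using walshSum_iidWeight (n := n) (β := β) ∅

lemma walsh_univ_mul (S : Finset (Fin n)) (z : Fin n → ℤˣ) :
    walsh univ z * walsh S z = walsh Sᶜ z := by
  have h : walsh univ z = walsh S z * walsh Sᶜ z := by
    simp [walsh, prod_mul_prod_compl]
  rw [h, mul_right_comm, walsh_mul_self, one_mul]

lemma Stab_eq_corr (f : (Fin n → ℤˣ) → ℝ) : Stab n β f = corr (iidWeight n β) f / 2 ^ n := rfl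

end IID

/-- The average of `φ` over the Hamming ball. -/
def ballAvg (n r : ℕ) (φ : (Fin n → ℤˣ) → ℝ) : ℝ := (∑ z ∈ hBall n r, φ z) / (hBall n r).card

/-- The uniform distribution on the Hamming ball. -/
def ballWeight (n r : ℕ) (z : Fin n → ℤˣ) : ℝ :=
  if z ∈ hBall n r then ((hBall n r).card : ℝ)⁻¹ else 0

section Ball

variable {n r : ℕ}

lemma mem_hBall {z : Fin n → ℤˣ} : z ∈ hBall n r ↔ hammingDist z 1 ≤ r := by simp [hBall]

lemma card_hBall_pos : (0 : ℝ) < (hBall n r).card := by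
  have : (1 : Fin n → ℤˣ) ∈ hBall n r := by simp [mem_hBall]
  exact_mod_cast card_pos.mpr ⟨_, this⟩

lemma sum_ballWeight_mul (φ : (Fin n → ℤˣ) → ℝ) :
    ∑ z, ballWeight n r z * φ z = ballAvg n r φ := by
  simp only [ballWeight, ite_mul, zero_mul, ballAvg, div_eq_inv_mul, mul_sum]
  rw [sum_ite_mem, univ_inter]

lemma walshSum_ballWeight (S : Finset (Fin n)) :
    walshSum (ballWeight n r) S = ballAvg n r (walsh S) := sum_ballWeight_mul _

lemma BStab_eq_corr (f : (Fin n → ℤˣ) → ℝ) :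
    BStab n r f = corr (ballWeight n r) f / 2 ^ n := by
  simp only [corr, BStab, sum_ballWeight_mul (fun z => _ * _), ballAvg, ← sum_div]
  rw [div_div, mul_comm (2 ^ n : ℝ)]

lemma ballAvg_mono {φ ψ : (Fin n → ℤˣ) → ℝ} (h : ∀ z ∈ hBall n r, φ z ≤ ψ z) :
    ballAvg n r φ ≤ ballAvg n r ψ :=
  div_le_div_of_nonneg_right (sum_le_sum h) card_hBall_pos.le

lemma ballAvg_const (c : ℝ) : ballAvg n r (fun _ => c) = c := by
  have := card_hBall_pos (n := n) (r := r)
  simp only [ballAvg, sum_const, nsmul_eq_mul]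
  field_simp

lemma ballAvg_sum {ι : Type*} (s : Finset ι) (φ : ι → (Fin n → ℤˣ) → ℝ) :
    ballAvg n r (fun z => ∑ i ∈ s, φ i z) = ∑ i ∈ s, ballAvg n r (φ i) := by
  simp only [ballAvg]; rw [sum_comm, sum_div]

lemma ballAvg_const_mul (c : ℝ) (φ : (Fin n → ℤˣ) → ℝ) :
    ballAvg n r (fun z => c * φ z) = c * ballAvg n r φ := by
  simp only [ballAvg, ← mul_sum, mul_div_assoc]

lemma ballAvg_sub (φ ψ : (Fin n → ℤˣ) → ℝ) :
    ballAvg n r (fun z => φ z - ψ z) = ballAvg n r φ - ballAvg n r ψ := by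
  simp only [ballAvg, sum_sub_distrib, sub_div]

lemma abs_ballAvg_le (φ : (Fin n → ℤˣ) → ℝ) :
    |ballAvg n r φ| ≤ ballAvg n r (fun z => |φ z|) := by
  rw [ballAvg, abs_div, abs_of_pos card_hBall_pos]
  exact div_le_div_of_nonneg_right (abs_sum_le_sum_abs _ _) card_hBall_pos.le

lemma abs_ballAvg_walsh_le (S : Finset (Fin n)) : |ballAvg n r (walsh S)| ≤ 1 := by
  refine (abs_ballAvg_le _).trans ?_
  simp [abs_walsh, ballAvg_const]

/-- Jensen's inequality for the square. -/
lemma sq_ballAvg_le (φ : (Fin n → ℤˣ) → ℝ) :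
    ballAvg n r φ ^ 2 ≤ ballAvg n r (fun z => φ z ^ 2) := by
  have hc := card_hBall_pos (n := n) (r := r)
  have h := sq_sum_le_card_mul_sum_sq (s := hBall n r) (f := φ)
  rw [ballAvg, ballAvg, div_pow, div_le_div_iff₀ (by positivity) hc]
  nlinarith

lemma hammingDist_eq_sum (z : Fin n → ℤˣ) :
    (hammingDist z 1 : ℝ) = ∑ i, (1 - coordR i z) / 2 := by
  rw [hammingDist, card_filter, Nat.cast_sum]
  refine sum_congr rfl fun i _ => ?_
  rcases coordR_eq_one_or i z with h | h
  · simp [h.1, h.2]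
  · have : (-1 : ℤˣ) ≠ 1 := by decide
    simp [h.1, h.2, this]

lemma sum_coordR (z : Fin n → ℤˣ) : ∑ i, coordR i z = n - 2 * hammingDist z 1 := by
  rw [hammingDist_eq_sum, ← sum_div, sum_sub_distrib]; simp; ring

lemma hammingDist_mul_flipAt (i : Fin n) (z : Fin n → ℤˣ) :
    (hammingDist (z * flipAt i) 1 : ℝ) = hammingDist z 1 + coordR i z := by
  have h : ∀ j, (1 - coordR j (z * flipAt i)) / 2 =
      (1 - coordR j z) / 2 + if j = i then coordR i z else 0 := by
    intro j
    rw [coordR_mul, coordR_flipAt]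
    split_ifs with hj
    · subst hj; ring
    · ring
  rw [hammingDist_eq_sum, hammingDist_eq_sum, sum_congr rfl fun j _ => h j, sum_add_distrib]
  simp

lemma sum_mul_flipAt (i : Fin n) (φ : (Fin n → ℤˣ) → ℝ) :
    ∑ z, φ (z * flipAt i) = ∑ z, φ z :=
  Equiv.sum_comp (Equiv.mulRight (flipAt i)) φ

lemma sum_hammingDist_mul_pred (g : ℕ → ℝ) :
    ∑ z : Fin n → ℤˣ, (hammingDist z 1 : ℝ) * g (hammingDist z 1 - 1) =
      ∑ z : Fin n → ℤˣ, (n - hammingDist z 1 : ℝ) * g (hammingDist z 1) := by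
  have h1 : ∀ z : Fin n → ℤˣ, (hammingDist z 1 : ℝ) * g (hammingDist z 1 - 1) =
      ∑ i, (1 - coordR i z) / 2 * g (hammingDist z 1 - 1) := fun z => by
    rw [← sum_mul, ← hammingDist_eq_sum]
  have h2 : ∀ z : Fin n → ℤˣ, (n - hammingDist z 1 : ℝ) * g (hammingDist z 1) =
      ∑ i, (1 + coordR i z) / 2 * g (hammingDist z 1) := fun z => by
    rw [← sum_mul, ← sum_div, sum_add_distrib, sum_coordR]; simp; left; ring
  simp_rw [h1, h2]
  rw [sum_comm]
  conv_rhs => rw [sum_comm]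
  refine sum_congr rfl fun i _ => ?_
  rw [← sum_mul_flipAt i]
  refine sum_congr rfl fun z _ => ?_
  rw [coordR_mul, coordR_flipAt, if_pos rfl]
  rcases coordR_eq_one_or i z with h | h
  · have hd := hammingDist_mul_flipAt i z
    rw [h.2] at hd
    have hd' : hammingDist (z * flipAt i) 1 = hammingDist z 1 + 1 := by exact_mod_cast hd
    rw [h.2, hd', Nat.add_sub_cancel]; norm_num
  · rw [h.2]; norm_num

lemma ballAvg_depth_sq_le (hr : 2 * r ≤ n) :
    ballAvg n r (fun z => ((r : ℝ) - hammingDist z 1) ^ 2) ≤ r / 2 := by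
  have key := sum_hammingDist_mul_pred (n := n) (fun t => ((r - t : ℕ) : ℝ))
  have restrict : ∀ φ : (Fin n → ℤˣ) → ℝ, (∀ z, z ∉ hBall n r → φ z = 0) →
      ∑ z, φ z = ∑ z ∈ hBall n r, φ z := fun φ h =>
    (sum_subset (subset_univ _) fun z _ hz => h z hz).symm
  rw [restrict, restrict] at key
  rotate_left
  · intro z hz
    rw [mem_hBall] at hz
    rw [Nat.sub_eq_zero_of_le (by omega)]; simp
  · intro z hz
    rw [mem_hBall] at hz
    rw [Nat.sub_eq_zero_of_le (by omega)]; simp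
  rw [← sub_eq_zero, ← sum_sub_distrib] at key
  have hle : ∀ z ∈ hBall n r, 2 * ((r : ℝ) - hammingDist z 1) ^ 2 - r ≤
      -((hammingDist z 1 : ℝ) * ((r - (hammingDist z 1 - 1) : ℕ) : ℝ) -
        (n - hammingDist z 1 : ℝ) * ((r - hammingDist z 1 : ℕ) : ℝ)) := by
    intro z hz
    rw [mem_hBall] at hz
    have hr' : (2 * r : ℝ) ≤ n := by exact_mod_cast hr
    generalize hammingDist z 1 = d at hz ⊢
    have hd : (d : ℝ) ≤ r := by exact_mod_cast hz
    rw [Nat.cast_sub hz]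
    rcases Nat.eq_zero_or_pos d with rfl | hpos
    · simp only [Nat.cast_zero]; nlinarith
    · rw [Nat.cast_sub (by omega), Nat.cast_sub hpos]
      push_cast
      nlinarith [mul_nonneg (sub_nonneg.2 hr') (sub_nonneg.2 hd)]
  have h := sum_le_sum hle
  rw [sum_neg_distrib, key, sum_sub_distrib, ← mul_sum, sum_const, nsmul_eq_mul] at h
  rw [ballAvg, div_le_iff₀ card_hBall_pos]
  linarith

lemma hammingDist_comp_perm (e : Equiv.Perm (Fin n)) (z : Fin n → ℤˣ) :
    hammingDist (z ∘ e) 1 = hammingDist z 1 := by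
  have : (hammingDist (z ∘ e) 1 : ℝ) = hammingDist z 1 := by
    rw [hammingDist_eq_sum, hammingDist_eq_sum]
    exact Equiv.sum_comp e fun i => (1 - coordR i z) / 2
  exact_mod_cast this

lemma ballAvg_comp_perm (e : Equiv.Perm (Fin n)) (φ : (Fin n → ℤˣ) → ℝ) :
    ballAvg n r (fun z => φ (z ∘ e)) = ballAvg n r φ := by
  rw [← sum_ballWeight_mul, ← sum_ballWeight_mul,
    ← (e.arrowCongr (Equiv.refl ℤˣ)).symm.sum_comp fun z => ballWeight n r z * φ z]
  refine sum_congr rfl fun z _ => ?_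
  have h : (e.arrowCongr (Equiv.refl ℤˣ)).symm z = z ∘ e := by ext; simp
  simp only [h, ballWeight, mem_hBall, hammingDist_comp_perm]

lemma coordR_comp_swap_left (i j : Fin n) (z : Fin n → ℤˣ) :
    coordR i (z ∘ Equiv.swap i j) = coordR j z := by simp [coordR]

lemma coordR_comp_swap_right (i j : Fin n) (z : Fin n → ℤˣ) :
    coordR j (z ∘ Equiv.swap i j) = coordR i z := by simp [coordR]

lemma coordR_comp_swap_of_ne {i j k : Fin n} (hi : k ≠ i) (hj : k ≠ j) (z : Fin n → ℤˣ) :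
    coordR k (z ∘ Equiv.swap i j) = coordR k z := by
  simp [coordR, Equiv.swap_apply_of_ne_of_ne hi hj]

lemma walsh_comp_swap_of_notMem {S : Finset (Fin n)} {i j : Fin n} (hi : i ∉ S) (hj : j ∉ S)
    (z : Fin n → ℤˣ) : walsh S (z ∘ Equiv.swap i j) = walsh S z :=
  prod_congr rfl fun _ hk => coordR_comp_swap_of_ne (ne_of_mem_of_not_mem hk hi)
    (ne_of_mem_of_not_mem hk hj) z

lemma ballAvg_walsh_insert_eq {S : Finset (Fin n)} {i j : Fin n} (hi : i ∉ S) (hj : j ∉ S) :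
    ballAvg n r (walsh (insert i S)) = ballAvg n r (walsh (insert j S)) := by
  rw [← ballAvg_comp_perm (Equiv.swap i j)]
  congr 1; ext z
  rw [walsh_insert hi, walsh_insert hj, coordR_comp_swap_left, walsh_comp_swap_of_notMem hi hj]

end Ball

section Bias

variable {n r : ℕ}

lemma ballAvg_walsh_mul_sum_coordR {S : Finset (Fin n)} {i : Fin n} (hi : i ∉ S) :
    ballAvg n r (fun z => walsh S z * ∑ j, coordR j z) =
      ∑ j ∈ S, ballAvg n r (walsh (S.erase j)) +
        (n - S.card : ℝ) * ballAvg n r (walsh (insert i S)) := by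
  simp_rw [mul_sum]
  rw [ballAvg_sum, ← sum_add_sum_compl S]
  congr 1
  · refine sum_congr rfl fun j hj => ?_
    congr 1; ext z; rw [walsh_erase hj, mul_comm]
  · have h : ∀ j ∈ Sᶜ, ballAvg n r (fun z => walsh S z * coordR j z) =
        ballAvg n r (walsh (insert i S)) := by
      intro j hj
      rw [mem_compl] at hj
      rw [ballAvg_walsh_insert_eq hi hj]
      congr 1; ext z; rw [walsh_insert hj, mul_comm]
    rw [sum_congr rfl h, sum_const, nsmul_eq_mul, card_compl, Fintype.card_fin,
      Nat.cast_sub (by simpa using card_le_univ S)]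

/-- If the empirical mean of the coordinates concentrates around `ρ`, then low-degree characters
have mean close to powers of `ρ`. -/
lemma abs_ballAvg_walsh_sub_pow_le {ρ c : ℝ} (hρ0 : 0 ≤ ρ) (hρ1 : ρ ≤ 1) (hc : 0 ≤ c)
    (hn : 0 < n)
    (h : ballAvg n r (fun z => ((∑ j, coordR j z) / n - ρ) ^ 2) ≤ c ^ 2) (S : Finset (Fin n)) :
    |ballAvg n r (walsh S) - ρ ^ S.card| ≤ S.card * (c + 2 * S.card / n) := by
  have hn' : (0 : ℝ) < n := by exact_mod_cast hn
  induction S using Finset.induction_on with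
  | empty =>
    have h1 : walsh (∅ : Finset (Fin n)) = fun _ => 1 := by ext; simp [walsh]
    simp [h1, ballAvg_const]
  | insert i S hi ih =>
    have hsq : |ballAvg n r (fun z => walsh S z * ((∑ j, coordR j z) / n - ρ))| ≤ c := by
      refine abs_le_of_sq_le_sq ((sq_ballAvg_le _).trans (le_trans (le_of_eq ?_) h)) hc
      congr 1; ext z
      rw [mul_pow, pow_two (walsh S z), walsh_mul_self, one_mul]
    have hsplit : ballAvg n r (fun z => walsh S z * ((∑ j, coordR j z) / n - ρ)) =
        (n : ℝ)⁻¹ * ballAvg n r (fun z => walsh S z * ∑ j, coordR j z) -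
          ρ * ballAvg n r (walsh S) := by
      rw [← ballAvg_const_mul, ← ballAvg_const_mul, ← ballAvg_sub]
      congr 1; ext z; ring
    rw [hsplit, ballAvg_walsh_mul_sum_coordR hi] at hsq
    have hA : |∑ j ∈ S, ballAvg n r (walsh (S.erase j))| ≤ S.card := by
      refine (abs_sum_le_sum_abs _ _).trans ?_
      refine (sum_le_sum fun j _ => abs_ballAvg_walsh_le (S.erase j)).trans ?_
      simp
    have hl := abs_ballAvg_walsh_le (r := r) (insert i S)
    rw [card_insert_of_notMem hi]
    push_cast
    generalize ballAvg n r (walsh (insert i S)) = l' at *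
    generalize ballAvg n r (walsh S) = l at *
    generalize ∑ j ∈ S, ballAvg n r (walsh (S.erase j)) = A at *
    have hk : (0 : ℝ) ≤ S.card := by positivity
    generalize hkk : (S.card : ℝ) = k at *
    have hA' : |A / n| ≤ k / n := by
      rw [abs_div, abs_of_pos hn']; gcongr
    have hl' : |k / n * l'| ≤ k / n := by
      rw [abs_mul, abs_of_nonneg (by positivity : 0 ≤ k / n)]
      exact mul_le_of_le_one_right (by positivity) hl
    have hρl : |ρ * (l - ρ ^ S.card)| ≤ k * (c + 2 * k / n) := by
      rw [abs_mul, abs_of_nonneg hρ0]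
      exact (mul_le_of_le_one_left (abs_nonneg _) hρ1).trans ih
    have hid : l' - ρ ^ (S.card + 1) = ((n : ℝ)⁻¹ * (A + (n - k) * l') - ρ * l) - A / n +
        k / n * l' + ρ * (l - ρ ^ S.card) := by
      field_simp; ring
    have hb : |l' - ρ ^ (S.card + 1)| ≤ c + k / n + k / n + k * (c + 2 * k / n) := by
      rw [hid]
      exact (abs_add_le _ _).trans (add_le_add ((abs_add_le _ _).trans
        (add_le_add ((abs_sub _ _).trans (add_le_add hsq hA')) hl')) hρl)
    refine hb.trans ?_
    have e : (k + 1) * (c + 2 * (k + 1) / n) - (c + k / n + k / n + k * (c + 2 * k / n)) =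
        2 * (k + 1) / n := by field_simp; ring
    have : 0 ≤ 2 * (k + 1) / n := by positivity
    linarith

lemma walsh_univ (z : Fin n → ℤˣ) : walsh univ z = (-1) ^ hammingDist z 1 := by
  have h : ∀ i, coordR i z = if z i ≠ 1 then -1 else 1 := by
    intro i
    rcases coordR_eq_one_or i z with h | h
    · simp [h.1, h.2]
    · have : (-1 : ℤˣ) ≠ 1 := by decide
      simp [h.1, h.2, this]
  simp_rw [walsh, h, hammingDist]
  rw [prod_ite]; simp

lemma two_mul_ballAvg_walsh {S : Finset (Fin n)} {i : Fin n} (hi : i ∈ S) :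
    2 * ballAvg n r (walsh S) =
      ∑ z, (ballWeight n r z - ballWeight n r (z * flipAt i)) * walsh S z := by
  have h1 := sum_ballWeight_mul (r := r) (walsh S)
  have h2 := sum_mul_flipAt i fun z => ballWeight n r z * walsh S z
  simp only [walsh_mul, walsh_flipAt, if_pos hi, mul_neg, mul_one, sum_neg_distrib] at h2
  simp_rw [sub_mul]
  rw [sum_sub_distrib]
  linarith

/-- The symmetry of the mean of characters on balls of even radius. -/
lemma ballAvg_walsh_eq_insert_compl (hr : Even r) {S : Finset (Fin n)} {i : Fin n} (hi : i ∈ S) :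
    ballAvg n r (walsh S) = ballAvg n r (walsh (insert i Sᶜ)) := by
  refine mul_left_cancel₀ (two_ne_zero (α := ℝ)) ?_
  rw [two_mul_ballAvg_walsh hi, two_mul_ballAvg_walsh (mem_insert_self i Sᶜ)]
  refine sum_congr rfl fun z _ => ?_
  rw [walsh_insert (by simpa using hi), ← walsh_univ_mul, walsh_univ]
  have hd := hammingDist_mul_flipAt i z
  simp only [ballWeight, mem_hBall]
  rcases coordR_eq_one_or i z with h | h <;> rw [h.2] at hd ⊢
  · have hd' : hammingDist (z * flipAt i) 1 = hammingDist z 1 + 1 := by exact_mod_cast hd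
    rw [hd']
    by_cases hz : hammingDist z 1 = r
    · rw [hz, hr.neg_one_pow]; ring
    · have : hammingDist z 1 ≤ r ↔ hammingDist z 1 + 1 ≤ r := by omega
      simp [this]
  · have hd' : hammingDist (z * flipAt i) 1 + 1 = hammingDist z 1 := by
      have : (hammingDist (z * flipAt i) 1 : ℝ) + 1 = hammingDist z 1 := by rw [hd]; ring
      exact_mod_cast this
    by_cases hz : hammingDist (z * flipAt i) 1 = r
    · rw [← hd', hz, pow_succ, hr.neg_one_pow]; ring
    · have : hammingDist z 1 ≤ r ↔ hammingDist (z * flipAt i) 1 ≤ r := by omega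
      simp [this]

lemma walsh_comp_swap {S : Finset (Fin n)} {i j : Fin n} (hi : i ∈ S) (hj : j ∉ S)
    (z : Fin n → ℤˣ) :
    walsh S (z ∘ Equiv.swap i j) = coordR i z * coordR j z * walsh S z := by
  have h : ∀ y : Fin n → ℤˣ, walsh S y = coordR i y * walsh (S.erase i) y := fun y => by
    rw [← walsh_insert (notMem_erase i S), insert_erase hi]
  rw [h, coordR_comp_swap_left, walsh_comp_swap_of_notMem (notMem_erase i S)
    (fun h => hj (mem_of_mem_erase h)), walsh_erase hi]
  ring

/-- Only vertices that agree on each of the disjoint pairs `(a, b a)` contribute to the mean of a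
character that contains `a` but not `b a`. -/
lemma ballAvg_walsh_eq_pairs {S : Finset (Fin n)} (b : Fin n → Fin n) (A : Finset (Fin n))
    (hA : A ⊆ S) (hb : ∀ a ∈ A, b a ∉ S) (hinj : Set.InjOn b A) :
    ballAvg n r (walsh S) =
      ballAvg n r (fun z => walsh S z * ∏ a ∈ A, ((1 + coordR a z * coordR (b a) z) / 2)) := by
  induction A using Finset.induction_on with
  | empty => simp
  | insert a A ha ih =>
    rw [ih ((subset_insert _ _).trans hA) (fun x hx => hb x (mem_insert_of_mem hx))
      (hinj.mono (by simp))]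
    have haS := hA (mem_insert_self a A)
    have hbS := hb a (mem_insert_self a A)
    rw [← sub_eq_zero, ← ballAvg_sub]
    set φ : (Fin n → ℤˣ) → ℝ := fun z =>
      walsh S z * ∏ x ∈ A, ((1 + coordR x z * coordR (b x) z) / 2) -
      walsh S z * ∏ x ∈ insert a A, ((1 + coordR x z * coordR (b x) z) / 2) with hφ
    have hanti : ∀ z, φ (z ∘ Equiv.swap a (b a)) = (-1) * φ z := by
      intro z
      have hprod : ∏ x ∈ A, ((1 + coordR x (z ∘ Equiv.swap a (b a)) *
          coordR (b x) (z ∘ Equiv.swap a (b a))) / 2) =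
          ∏ x ∈ A, ((1 + coordR x z * coordR (b x) z) / 2) := by
        refine prod_congr rfl fun x hx => ?_
        have hxS := hA (mem_insert_of_mem hx)
        have hbx := hb x (mem_insert_of_mem hx)
        have hxa : x ≠ a := ne_of_mem_of_not_mem hx ha
        rw [coordR_comp_swap_of_ne hxa (ne_of_mem_of_not_mem hxS hbS),
          coordR_comp_swap_of_ne (ne_of_mem_of_not_mem haS hbx).symm
            (fun h => hxa (hinj (by simp [hx]) (by simp) h))]
      simp only [hφ, prod_insert ha, hprod, walsh_comp_swap haS hbS, coordR_comp_swap_left,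
        coordR_comp_swap_right]
      have h1 := coordR_mul_self a z
      have h2 := coordR_mul_self (b a) z
      generalize ∏ x ∈ A, ((1 + coordR x z * coordR (b x) z) / 2) = P
      generalize coordR a z = s at *
      generalize coordR (b a) z = t at *
      linear_combination (-(walsh S z * P) / 2) * (t * t * h1 + h2)
    have h := ballAvg_comp_perm (r := r) (Equiv.swap a (b a)) φ
    simp_rw [hanti] at h
    rw [ballAvg_const_mul] at h
    linarith

lemma abs_ballAvg_walsh_le_of_card {ρ δ : ℝ} {L : ℕ} {S : Finset (Fin n)}
    (hS : L ≤ S.card) (hS' : L ≤ Sᶜ.card)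
    (hδ : ∀ T : Finset (Fin n), T.card ≤ 2 * L → ballAvg n r (walsh T) ≤ ρ ^ T.card + δ) :
    |ballAvg n r (walsh S)| ≤ ((1 + ρ ^ 2) / 2) ^ L + δ := by
  obtain ⟨A, hAS, hA⟩ := exists_subset_card_eq hS
  obtain ⟨B, hBS, hB⟩ := exists_subset_card_eq hS'
  obtain ⟨e⟩ : Nonempty (A ≃ B) := ⟨equivOfCardEq (hA.trans hB.symm)⟩
  set b : Fin n → Fin n := fun i => if h : i ∈ A then e ⟨i, h⟩ else i with hbdef
  have hbB : ∀ a ∈ A, b a ∈ B := fun a ha => by simp [hbdef, ha]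
  have hbS : ∀ a ∈ A, b a ∉ S := fun a ha => mem_compl.1 (hBS (hbB a ha))
  have hinj : Set.InjOn b A := by
    intro x hx y hy hxy
    rw [mem_coe] at hx hy
    simp only [hbdef, hx, hy, dif_pos] at hxy
    simpa using e.injective (Subtype.ext hxy)
  have hdisj : ∀ T ∈ A.powerset, Disjoint T (T.image b) := by
    intro T hT
    rw [mem_powerset] at hT
    rw [disjoint_left]
    intro x hx hx'
    obtain ⟨y, hy, rfl⟩ := mem_image.1 hx'
    exact hbS y (hT hy) (hAS (hT hx))
  have hcard : ∀ T ∈ A.powerset, (T ∪ T.image b).card = 2 * T.card := by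
    intro T hT
    rw [card_union_of_disjoint (hdisj T hT), card_image_of_injOn
      (hinj.mono (by simpa using mem_powerset.1 hT))]
    ring
  rw [ballAvg_walsh_eq_pairs b A hAS hbS hinj]
  have hexp : ∀ z : Fin n → ℤˣ, |walsh S z * ∏ a ∈ A, ((1 + coordR a z * coordR (b a) z) / 2)| =
      ∑ T ∈ A.powerset, (1 / 2) ^ L * walsh (T ∪ T.image b) z := by
    intro z
    rw [abs_mul, abs_walsh, one_mul, abs_of_nonneg, prod_div_distrib, prod_const, hA,
      prod_one_add, sum_div]
    · refine sum_congr rfl fun T hT => ?_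
      rw [walsh, prod_union (hdisj T hT), prod_image
        (hinj.mono (by simpa using mem_powerset.1 hT)), prod_mul_distrib]
      simp only [one_div, inv_pow]; ring
    · refine prod_nonneg fun a _ => ?_
      rcases coordR_eq_one_or a z with h | h <;> rcases coordR_eq_one_or (b a) z with h' | h' <;>
        rw [h.2, h'.2] <;> norm_num
  refine (abs_ballAvg_le _).trans ?_
  simp_rw [hexp]
  rw [ballAvg_sum]
  have hterm : ∀ T ∈ A.powerset, ballAvg n r (fun z => (1 / 2) ^ L * walsh (T ∪ T.image b) z) ≤
      (1 / 2) ^ L * ((ρ ^ 2) ^ T.card + δ) := by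
    intro T hT
    rw [ballAvg_const_mul]
    refine mul_le_mul_of_nonneg_left ?_ (by positivity)
    have h := hδ (T ∪ T.image b) (by
      rw [hcard T hT]
      have := card_le_card (mem_powerset.1 hT)
      omega)
    rwa [hcard T hT, pow_mul] at h
  refine (sum_le_sum hterm).trans (le_of_eq ?_)
  have hbin : ∑ T ∈ A.powerset, (ρ ^ 2) ^ T.card = (1 + ρ ^ 2) ^ L := by
    have := prod_one_add (f := fun _ : Fin n => ρ ^ 2) A
    simp only [prod_const, hA] at this
    exact this.symm
  rw [← mul_sum, sum_add_distrib, hbin, sum_const, card_powerset, hA, nsmul_eq_mul, mul_add,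
    ← mul_assoc]
  push_cast
  rw [← mul_pow, ← mul_pow]
  norm_num
  ring

end Bias

section Asymptotics

variable {α β : ℝ}

lemma ballAvg_mean_sub_sq_le (hβ1 : 0 < β) (hβ2 : β ≤ 1 / 2) {n : ℕ} (hn : 0 < n) :
    ballAvg n (2 * ⌊β * n / 2⌋₊) (fun z => ((∑ j, coordR j z) / n - (1 - 2 * β)) ^ 2) ≤
      Real.sqrt (34 / n) ^ 2 := by
  have hn' : (1 : ℝ) ≤ n := by exact_mod_cast hn
  have hn0 : (0 : ℝ) < n := by linarith
  have hlow := Nat.lt_floor_add_one (β * n / 2)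
  have hup := Nat.floor_le (by positivity : 0 ≤ β * n / 2)
  have hR : ((2 * ⌊β * n / 2⌋₊ : ℕ) : ℝ) = 2 * (⌊β * n / 2⌋₊ : ℝ) := by push_cast; ring
  generalize 2 * ⌊β * n / 2⌋₊ = r at *
  have hr1 : β * n - 2 ≤ r := by linarith
  have hr2 : (r : ℝ) ≤ β * n := by linarith
  have hr3 : (2 * r : ℝ) ≤ n := by nlinarith
  have hvar := ballAvg_depth_sq_le (n := n) (r := r) (by exact_mod_cast hr3)
  rw [Real.sq_sqrt (by positivity)]
  have hpt : ∀ z ∈ hBall n r, ((∑ j, coordR j z) / n - (1 - 2 * β)) ^ 2 ≤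
      8 / n ^ 2 * (((r : ℝ) - hammingDist z 1) ^ 2 - (-4)) := by
    intro z _
    rw [sum_coordR]
    have h : ((n - 2 * hammingDist z 1 : ℝ) / n - (1 - 2 * β)) ^ 2 =
        4 / n ^ 2 * ((β * n - r) + (r - hammingDist z 1)) ^ 2 := by
      field_simp; ring
    rw [h]
    have h2 : ((β * n - r) + ((r : ℝ) - hammingDist z 1)) ^ 2 ≤
        2 * (((r : ℝ) - hammingDist z 1) ^ 2 + 4) := by
      have : (β * n - r) ^ 2 ≤ 4 := by nlinarith
      nlinarith [sq_nonneg ((β * n - r) - ((r : ℝ) - hammingDist z 1))]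
    calc _ ≤ 4 / (n : ℝ) ^ 2 * (2 * (((r : ℝ) - hammingDist z 1) ^ 2 + 4)) := by gcongr
      _ = _ := by ring
  refine (ballAvg_mono hpt).trans ?_
  rw [ballAvg_const_mul, ballAvg_sub, ballAvg_const]
  calc _ ≤ 8 / (n : ℝ) ^ 2 * (n / 4 - (-4)) := by gcongr; linarith
    _ ≤ 34 / n := by
      rw [div_mul_eq_mul_div, div_le_div_iff₀ (by positivity) hn0]
      nlinarith

lemma eventually_abs_ballAvg_walsh_sub_pow_le (hβ1 : 0 < β) (hβ2 : β ≤ 1 / 2) (K : ℕ) {ε : ℝ}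
    (hε : 0 < ε) : ∀ᶠ n : ℕ in atTop, ∀ S : Finset (Fin n), S.card ≤ K →
      |ballAvg n (2 * ⌊β * n / 2⌋₊) (walsh S) - (1 - 2 * β) ^ S.card| ≤ ε := by
  have hlim : Tendsto (fun n : ℕ => (K : ℝ) * (Real.sqrt (34 / n) + 2 * K / n)) atTop (nhds 0) := by
    have h1 : Tendsto (fun n : ℕ => Real.sqrt (34 / n)) atTop (nhds 0) := by
      have := (tendsto_const_div_atTop_nhds_zero_nat (34 : ℝ)).sqrt
      simpa using this
    have h2 := tendsto_const_div_atTop_nhds_zero_nat (2 * K : ℝ)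
    simpa using (h1.add h2).const_mul (K : ℝ)
  filter_upwards [hlim.eventually_lt_const hε, eventually_gt_atTop 0] with n hn hpos S hS
  refine (abs_ballAvg_walsh_sub_pow_le (by linarith) (by linarith) (Real.sqrt_nonneg _) hpos
    (ballAvg_mean_sub_sq_le hβ1 hβ2 hpos) S).trans (le_trans ?_ hn.le)
  have : (S.card : ℝ) ≤ K := by exact_mod_cast hS
  gcongr

lemma eventually_ballAvg_walsh_le (hβ1 : 0 < β) (hβ2 : β ≤ 1 / 2) {ε : ℝ} (hε : 0 < ε) :
    ∀ᶠ n : ℕ in atTop, ∀ S : Finset (Fin n),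
      ballAvg n (2 * ⌊β * n / 2⌋₊) (walsh S) ≤
        (1 - 2 * β) ^ S.card + (1 - 2 * β) * (1 - 2 * β) ^ Sᶜ.card + ε := by
  have hρ0 : 0 ≤ 1 - 2 * β := by linarith
  have hρ1 : 1 - 2 * β < 1 := by linarith
  have hq : (1 + (1 - 2 * β) ^ 2) / 2 < 1 := by nlinarith
  obtain ⟨L, hL⟩ := exists_pow_lt_of_lt_one (half_pos hε) hq
  filter_upwards [eventually_abs_ballAvg_walsh_sub_pow_le hβ1 hβ2 (2 * L + 1) (half_pos hε)]
    with n hn S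
  have hδ : ∀ T : Finset (Fin n), T.card ≤ 2 * L + 1 →
      ballAvg n (2 * ⌊β * n / 2⌋₊) (walsh T) ≤ (1 - 2 * β) ^ T.card + ε / 2 := fun T hT => by
    linarith [(abs_le.1 (hn T hT)).2]
  have hp1 : 0 ≤ (1 - 2 * β) ^ S.card := by positivity
  have hp2 : 0 ≤ (1 - 2 * β) * (1 - 2 * β) ^ Sᶜ.card := by positivity
  by_cases h1 : S.card ≤ L
  · linarith [hδ S (by omega)]
  by_cases h2 : Sᶜ.card ≤ L
  · obtain ⟨i, hi⟩ : S.Nonempty := card_pos.1 (by omega)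
    have hc : (insert i Sᶜ).card = Sᶜ.card + 1 := card_insert_of_notMem (by simpa using hi)
    rw [ballAvg_walsh_eq_insert_compl (even_two_mul _) hi]
    have := hδ (insert i Sᶜ) (by omega)
    rw [hc, pow_succ'] at this
    linarith
  · have := abs_ballAvg_walsh_le_of_card (le_of_not_ge h1) (le_of_not_ge h2)
      fun T hT => hδ T (by omega)
    linarith [le_abs_self (ballAvg n (2 * ⌊β * n / 2⌋₊) (walsh S))]

lemma eventually_BStab_le (hβ1 : 0 < β) (hβ2 : β ≤ 1 / 2) {ε : ℝ} (hε : 0 < ε) :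
    ∀ᶠ n : ℕ in atTop, ∀ f : (Fin n → ℤˣ) → ℝ, (∀ x, 0 ≤ f x) → (∀ x, f x ≤ 1) →
      BStab n (2 * ⌊β * n / 2⌋₊) f ≤ 2 * (1 - β) * Stab n β f + ε := by
  filter_upwards [eventually_ballAvg_walsh_le hβ1 hβ2 hε] with n hn f hf0 hf1
  set w : (Fin n → ℤˣ) → ℝ := fun z => iidWeight n β z +
    (1 - 2 * β) * (iidWeight n β z * walsh univ z) + ε * (if z = 1 then 1 else 0) with hw
  have hcorr : corr (ballWeight n (2 * ⌊β * n / 2⌋₊)) f ≤ corr w f := by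
    refine corr_le_corr_of_walshSum_le fun S _ => ?_
    rw [walshSum_ballWeight]
    refine (hn S).trans (le_of_eq ?_)
    rw [← walshSum_iidWeight S, ← walshSum_iidWeight Sᶜ]
    simp only [walshSum, hw, add_mul, sum_add_distrib, mul_assoc, ← mul_sum, walsh_univ_mul]
    simp [walsh, coordR]
  have hle : corr w f ≤ 2 * (1 - β) * corr (iidWeight n β) f + ε * 2 ^ n := by
    have hx : ∀ x, ∑ z, w z * (f x * f (x * z)) ≤
        2 * (1 - β) * ∑ z, iidWeight n β z * (f x * f (x * z)) + ε := by
      intro x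
      have hz : ∀ z, w z * (f x * f (x * z)) ≤
          2 * (1 - β) * (iidWeight n β z * (f x * f (x * z))) + ε * (if z = 1 then 1 else 0) := by
        intro z
        have hff : 0 ≤ f x * f (x * z) := mul_nonneg (hf0 _) (hf0 _)
        have hff1 : f x * f (x * z) ≤ 1 := mul_le_one₀ (hf1 _) (hf0 _) (hf1 _)
        have hi := iidWeight_nonneg hβ1.le (by linarith) z
        have hχ : walsh univ z ≤ 1 := (le_abs_self _).trans (abs_walsh univ z).le
        have h1 : iidWeight n β z * walsh univ z ≤ iidWeight n β z :=
          mul_le_of_le_one_right hi hχ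
        have h2 : iidWeight n β z + (1 - 2 * β) * (iidWeight n β z * walsh univ z) ≤
            2 * (1 - β) * iidWeight n β z := by
          nlinarith [mul_le_mul_of_nonneg_left h1 (by linarith : 0 ≤ 1 - 2 * β)]
        have h3 : ε * (if z = 1 then 1 else 0) * (f x * f (x * z)) ≤
            ε * (if z = 1 then 1 else 0) :=
          mul_le_of_le_one_right (by positivity) hff1
        have h4 := mul_le_mul_of_nonneg_right h2 hff
        rw [hw]
        linarith
      refine (sum_le_sum fun z _ => hz z).trans (le_of_eq ?_)
      rw [sum_add_distrib, ← mul_sum, ← mul_sum]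
      simp
    refine (sum_le_sum fun x _ => hx x).trans (le_of_eq ?_)
    rw [sum_add_distrib, ← mul_sum, sum_const, card_univ, nsmul_eq_mul]
    simp [corr]; ring
  rw [BStab_eq_corr, Stab_eq_corr, div_le_iff₀ (by positivity)]
  refine hcorr.trans (hle.trans (le_of_eq ?_))
  field_simp

lemma indic_nonneg {n : ℕ} (A : Finset (Fin n → ℤˣ)) (x : Fin n → ℤˣ) : 0 ≤ indic n A x := by
  unfold indic; split_ifs <;> norm_num

lemma indic_le_one {n : ℕ} (A : Finset (Fin n → ℤˣ)) (x : Fin n → ℤˣ) : indic n A x ≤ 1 := by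
  unfold indic; split_ifs <;> norm_num

lemma indic_mono {n : ℕ} {A B : Finset (Fin n → ℤˣ)} (h : A ⊆ B) (x : Fin n → ℤˣ) :
    indic n A x ≤ indic n B x := by
  unfold indic
  split_ifs with hA hB
  · exact le_rfl
  · exact absurd (h hA) hB
  · norm_num
  · exact le_rfl

lemma corr_le_two_pow {n : ℕ} {w f : (Fin n → ℤˣ) → ℝ} (hw : ∀ z, 0 ≤ w z) (hw1 : ∑ z, w z = 1)
    (hf0 : ∀ x, 0 ≤ f x) (hf1 : ∀ x, f x ≤ 1) : corr w f ≤ 2 ^ n := by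
  have hx : ∀ x, ∑ z, w z * (f x * f (x * z)) ≤ 1 := fun x => by
    rw [← hw1]
    exact sum_le_sum fun z _ =>
      mul_le_of_le_one_right (hw z) (mul_le_one₀ (hf1 _) (hf0 _) (hf1 _))
  refine (sum_le_sum fun x _ => hx x).trans (le_of_eq ?_)
  simp

lemma corr_mono {n : ℕ} {w f g : (Fin n → ℤˣ) → ℝ} (hw : ∀ z, 0 ≤ w z) (hf0 : ∀ x, 0 ≤ f x)
    (hfg : ∀ x, f x ≤ g x) : corr w f ≤ corr w g :=
  sum_le_sum fun _ _ => sum_le_sum fun z _ => mul_le_mul_of_nonneg_left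
    (mul_le_mul (hfg _) (hfg _) (hf0 _) ((hf0 _).trans (hfg _))) (hw z)

lemma ballWeight_nonneg {n r : ℕ} (z : Fin n → ℤˣ) : 0 ≤ ballWeight n r z := by
  unfold ballWeight; positivity

lemma sum_ballWeight {n r : ℕ} : ∑ z, ballWeight n r z = 1 := by
  simpa [ballAvg_const] using sum_ballWeight_mul (n := n) (r := r) fun _ => 1

lemma BStab_indic_mem_Icc {n r : ℕ} (A : Finset (Fin n → ℤˣ)) :
    BStab n r (indic n A) ∈ Set.Icc 0 1 := by
  rw [BStab_eq_corr]
  refine ⟨div_nonneg (sum_nonneg fun x _ => sum_nonneg fun z _ => mul_nonneg (ballWeight_nonneg z)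
    (mul_nonneg (indic_nonneg A _) (indic_nonneg A _))) (by positivity), ?_⟩
  rw [div_le_one (by positivity)]
  exact corr_le_two_pow ballWeight_nonneg sum_ballWeight (indic_nonneg A) (indic_le_one A)

lemma Stab_indic_le_one (h0 : 0 ≤ β) (h1 : β ≤ 1) {n : ℕ} (A : Finset (Fin n → ℤˣ)) :
    Stab n β (indic n A) ≤ 1 := by
  rw [Stab_eq_corr, div_le_one (by positivity)]
  exact corr_le_two_pow (iidWeight_nonneg h0 h1) sum_iidWeight (indic_nonneg A) (indic_le_one A)

lemma BStab_le_GammaB {n M r : ℕ} {A : Finset (Fin n → ℤˣ)} (hA : A.card = M) :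
    BStab n r (indic n A) ≤ GammaB n M r :=
  le_csSup ⟨1, by rintro y ⟨B, -, rfl⟩; exact (BStab_indic_mem_Icc B).2⟩ ⟨A, hA, rfl⟩

lemma Stab_le_GammaIID (h0 : 0 ≤ β) (h1 : β ≤ 1) {n M : ℕ} {A : Finset (Fin n → ℤˣ)}
    (hA : A.card = M) : Stab n β (indic n A) ≤ GammaIID n M β :=
  le_csSup ⟨1, by rintro y ⟨B, -, rfl⟩; exact Stab_indic_le_one h0 h1 B⟩ ⟨A, hA, rfl⟩

lemma GammaB_mem_Icc {n M r : ℕ} : GammaB n M r ∈ Set.Icc 0 1 :=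
  ⟨Real.sSup_nonneg (by rintro y ⟨B, -, rfl⟩; exact (BStab_indic_mem_Icc B).1),
    Real.sSup_le (by rintro y ⟨B, -, rfl⟩; exact (BStab_indic_mem_Icc B).2) zero_le_one⟩

lemma GammaIID_le_GammaIIDlim (h0 : 0 ≤ β) (h1 : β ≤ 1) (n : ℕ) :
    GammaIID n ⌊α * 2 ^ n⌋₊ β ≤ GammaIIDlim α β :=
  le_ciSup (f := fun n : ℕ => GammaIID n ⌊α * 2 ^ n⌋₊ β) ⟨1, by
    rintro y ⟨n, rfl⟩
    exact Real.sSup_le (by rintro y ⟨B, -, rfl⟩; exact Stab_indic_le_one h0 h1 B) zero_le_one⟩ n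

lemma floor_mul_two_pow_le (hα1 : 0 < α) (hα2 : α ≤ 1 / 2) (n : ℕ) :
    ⌊α * 2 ^ n⌋₊ ≤ Fintype.card (Fin n → ℤˣ) := by
  have h : ((2 ^ n : ℕ) : ℝ) = 2 ^ n := by push_cast; rfl
  have : ⌊α * 2 ^ n⌋₊ ≤ 2 ^ n := by
    refine Nat.floor_le_of_le ?_
    rw [h]
    exact mul_le_of_le_one_left (by positivity) (by linarith)
  simpa using this

lemma exists_card_eq_floor (hα1 : 0 < α) (hα2 : α ≤ 1 / 2) (n : ℕ) :
    ∃ A : Finset (Fin n → ℤˣ), A.card = ⌊α * 2 ^ n⌋₊ := by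
  obtain ⟨A, -, hA⟩ := exists_subset_card_eq (s := (univ : Finset (Fin n → ℤˣ)))
    (by simpa using floor_mul_two_pow_le hα1 hα2 n)
  exact ⟨A, hA⟩

/-- The cylinder over `A`, obtained by appending `m` free coordinates. -/
def cylinder {k : ℕ} (m : ℕ) (A : Finset (Fin k → ℤˣ)) : Finset (Fin (k + m) → ℤˣ) :=
  univ.filter fun x => (fun i => x (Fin.castAdd m i)) ∈ A

lemma indic_cylinder {k m : ℕ} (A : Finset (Fin k → ℤˣ)) (x : Fin (k + m) → ℤˣ) :
    indic (k + m) (cylinder m A) x = indic k A (fun i => x (Fin.castAdd m i)) := by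
  simp [indic, cylinder]

lemma sum_cube_add {k m : ℕ} (g : (Fin (k + m) → ℤˣ) → ℝ) :
    ∑ x, g x = ∑ x : Fin k → ℤˣ, ∑ y : Fin m → ℤˣ, g (Fin.append x y) := by
  rw [← Equiv.sum_comp (Fin.appendEquiv k m) g, Fintype.sum_prod_type]
  rfl

lemma card_cylinder {k m : ℕ} (A : Finset (Fin k → ℤˣ)) :
    (cylinder m A).card = A.card * 2 ^ m := by
  have h : ((cylinder m A).card : ℝ) = A.card * 2 ^ m := by
    have e : ∀ (n : ℕ) (B : Finset (Fin n → ℤˣ)), (B.card : ℝ) = ∑ x, indic n B x := by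
      intro n B; simp [indic]
    rw [e, sum_cube_add, e, sum_mul]
    refine sum_congr rfl fun x _ => ?_
    simp [indic_cylinder, mul_comm]
  exact_mod_cast h

lemma Stab_indic_cylinder {k m : ℕ} (A : Finset (Fin k → ℤˣ)) :
    Stab (k + m) β (indic (k + m) (cylinder m A)) = Stab k β (indic k A) := by
  have hw : ∀ (z : Fin k → ℤˣ) (u : Fin m → ℤˣ),
      iidWeight (k + m) β (Fin.append z u) = iidWeight k β z * iidWeight m β u := by
    intro z u
    simp [iidWeight, Fin.prod_univ_add]
  have h : corr (iidWeight (k + m) β) (indic (k + m) (cylinder m A)) =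
      2 ^ m * corr (iidWeight k β) (indic k A) := by
    simp only [corr, sum_cube_add, indic_cylinder, Pi.mul_apply, Fin.append_left, hw]
    rw [mul_sum]
    refine sum_congr rfl fun x _ => ?_
    rw [sum_const, card_univ, nsmul_eq_mul]
    congr 1
    · simp
    · refine sum_congr rfl fun z _ => ?_
      rw [← sum_mul, ← mul_sum, sum_iidWeight, mul_one]
      rfl
  rw [Stab_eq_corr, Stab_eq_corr, h, pow_add]
  field_simp

lemma walshSum_indic_cylinder {k m : ℕ} (A : Finset (Fin k → ℤˣ)) {S : Finset (Fin (k + m))}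
    {j : Fin m} (hj : Fin.natAdd k j ∈ S) :
    walshSum (indic (k + m) (cylinder m A)) S = 0 := by
  have h := sum_mul_flipAt (Fin.natAdd k j) fun x =>
    indic (k + m) (cylinder m A) x * walsh S x
  have hx : ∀ x : Fin (k + m) → ℤˣ, indic (k + m) (cylinder m A) (x * flipAt (Fin.natAdd k j)) =
      indic (k + m) (cylinder m A) x := by
    intro x
    rw [indic_cylinder, indic_cylinder]
    congr 1; ext i
    have : Fin.castAdd m i ≠ Fin.natAdd k j := fun h => by
      have := congrArg Fin.val h
      simp at this
      omega
    simp [flipAt, this]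
  simp only [hx, walsh_mul, walsh_flipAt, if_pos hj, mul_neg, mul_one, sum_neg_distrib] at h
  unfold walshSum
  linarith

lemma card_le_of_walshSum_indic_cylinder_ne_zero {k m : ℕ} {A : Finset (Fin k → ℤˣ)}
    {S : Finset (Fin (k + m))} (h : walshSum (indic (k + m) (cylinder m A)) S ≠ 0) :
    S.card ≤ k := by
  have hsub : S ⊆ univ.image (Fin.castAdd m : Fin k → Fin (k + m)) := by
    intro i hi
    induction i using Fin.addCases with
    | left i => simp
    | right j => exact absurd (walshSum_indic_cylinder A hi) h
  simpa using (card_le_card hsub).trans card_image_le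

lemma eventually_GammaIID_sub_le_GammaB (hα1 : 0 < α) (hα2 : α ≤ 1 / 2) (hβ1 : 0 < β)
    (hβ2 : β ≤ 1 / 2) (k : ℕ) {ε : ℝ} (hε : 0 < ε) :
    ∀ᶠ n : ℕ in atTop, GammaIID k ⌊α * 2 ^ k⌋₊ β - ε ≤
      GammaB n ⌊α * 2 ^ n⌋₊ (2 * ⌊β * n / 2⌋₊) := by
  filter_upwards [eventually_abs_ballAvg_walsh_sub_pow_le hβ1 hβ2 k hε, eventually_ge_atTop k]
    with n hn hkn
  obtain ⟨m, rfl⟩ := Nat.exists_eq_add_of_le hkn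
  rw [sub_le_iff_le_add]
  obtain ⟨A₀, hA₀⟩ := exists_card_eq_floor hα1 hα2 k
  refine csSup_le ⟨_, A₀, hA₀, rfl⟩ ?_
  rintro y ⟨A, hA, rfl⟩
  have hcard : (cylinder m A).card ≤ ⌊α * 2 ^ (k + m)⌋₊ := by
    rw [card_cylinder, hA]
    refine Nat.le_floor ?_
    push_cast
    rw [pow_add, ← mul_assoc]
    gcongr
    exact Nat.floor_le (by positivity)
  obtain ⟨B, hAB, -, hB⟩ := exists_subsuperset_card_eq (subset_univ (cylinder m A)) hcard
    (by simpa using floor_mul_two_pow_le hα1 hα2 (k + m))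
  set r := 2 * ⌊β * (k + m : ℕ) / 2⌋₊
  set f := indic (k + m) (cylinder m A) with hf
  have h1 : BStab (k + m) r f ≤ GammaB (k + m) ⌊α * 2 ^ (k + m)⌋₊ r := by
    refine le_trans ?_ (BStab_le_GammaB hB)
    rw [BStab_eq_corr, BStab_eq_corr]
    exact div_le_div_of_nonneg_right
      (corr_mono ballWeight_nonneg (indic_nonneg _) (indic_mono hAB)) (by positivity)
  set δ : (Fin (k + m) → ℤˣ) → ℝ := fun z => if z = 1 then 1 else 0 with hδ
  have h2 : corr (iidWeight (k + m) β) f ≤ corr (fun z => ballWeight (k + m) r z + ε * δ z) f := by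
    refine corr_le_corr_of_walshSum_le fun S hS => ?_
    have hle := (abs_le.1 (hn S (card_le_of_walshSum_indic_cylinder_ne_zero hS))).1
    have e : walshSum (fun z => ballWeight (k + m) r z + ε * δ z) S =
        walshSum (ballWeight (k + m) r) S + ε := by
      simp only [walshSum, add_mul, sum_add_distrib, mul_assoc, ← mul_sum]
      simp [hδ, walsh, coordR]
    rw [e, walshSum_iidWeight, walshSum_ballWeight]
    linarith
  have h3 : corr (fun z => ballWeight (k + m) r z + ε * δ z) f ≤
      corr (ballWeight (k + m) r) f + ε * 2 ^ (k + m) := by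
    have e : corr (fun z => ballWeight (k + m) r z + ε * δ z) f =
        corr (ballWeight (k + m) r) f + ε * corr δ f := by
      simp only [corr, add_mul, sum_add_distrib, mul_assoc, ← mul_sum]
    rw [e]
    gcongr
    refine corr_le_two_pow (fun z => ?_) (by simp [hδ]) (indic_nonneg _) (indic_le_one _)
    rw [hδ]; positivity
  rw [← Stab_indic_cylinder (m := m) A]
  refine le_trans ?_ (add_le_add_left h1 ε)
  rw [Stab_eq_corr, BStab_eq_corr, div_le_iff₀ (by positivity)]
  refine h2.trans (h3.trans (le_of_eq ?_))
  field_simp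

lemma eventually_GammaB_le (hα1 : 0 < α) (hα2 : α ≤ 1 / 2) (hβ1 : 0 < β) (hβ2 : β ≤ 1 / 2)
    {ε : ℝ} (hε : 0 < ε) :
    ∀ᶠ n : ℕ in atTop, GammaB n ⌊α * 2 ^ n⌋₊ (2 * ⌊β * n / 2⌋₊) ≤
      2 * (1 - β) * GammaIIDlim α β + ε := by
  filter_upwards [eventually_BStab_le hβ1 hβ2 hε] with n hn
  obtain ⟨A₀, hA₀⟩ := exists_card_eq_floor hα1 hα2 n
  refine csSup_le ⟨_, A₀, hA₀, rfl⟩ ?_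
  rintro y ⟨A, hA, rfl⟩
  refine (hn _ (indic_nonneg A) (indic_le_one A)).trans ?_
  have h : Stab n β (indic n A) ≤ GammaIIDlim α β :=
    (Stab_le_GammaIID hβ1.le (by linarith) hA).trans
      (GammaIID_le_GammaIIDlim hβ1.le (by linarith) n)
  have : 0 ≤ 1 - β := by linarith
  gcongr

end Asymptotics

/-- from Theorem 5: bounds on `liminf`/`limsup` of
`b_n := Γ_B^(n)(⌊α·2^n⌋, 2⌊βn/2⌋)` for `0 < α, β ≤ 1/2`. -/
theorem gammaB_even_bounds (α β : ℝ) (hα1 : 0 < α) (hα2 : α ≤ 1 / 2)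
    (hβ1 : 0 < β) (hβ2 : β ≤ 1 / 2) :
    GammaIIDlim α β ≤
        liminf (fun n : ℕ => GammaB n ⌊α * 2 ^ n⌋₊ (2 * ⌊β * n / 2⌋₊)) atTop ∧
    limsup (fun n : ℕ => GammaB n ⌊α * 2 ^ n⌋₊ (2 * ⌊β * n / 2⌋₊)) atTop ≤
        2 * (1 - β) * GammaIIDlim α β := by
  set b : ℕ → ℝ := fun n => GammaB n ⌊α * 2 ^ n⌋₊ (2 * ⌊β * n / 2⌋₊)
  have hlow : atTop.IsBoundedUnder (· ≥ ·) b :=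
    isBoundedUnder_of ⟨0, fun n => GammaB_mem_Icc.1⟩
  have hup : atTop.IsBoundedUnder (· ≤ ·) b :=
    isBoundedUnder_of ⟨1, fun n => GammaB_mem_Icc.2⟩
  constructor
  · refine ciSup_le fun k => le_of_forall_sub_le fun ε hε => ?_
    exact le_liminf_of_le hup.isCoboundedUnder_ge
      (eventually_GammaIID_sub_le_GammaB hα1 hα2 hβ1 hβ2 k hε)
  · refine le_of_forall_pos_le_add fun ε hε => ?_
    exact limsup_le_of_le hlow.isCoboundedUnder_le (eventually_GammaB_le hα1 hα2 hβ1 hβ2 hε)
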